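/- The satisfiability problem for LTL_NT is decidable: there is an algorithm which, given any LTL formula φ, decides whether there exist a non-transitive linear frame, a valuation, and a point at which φ is true. -/

import Mathlib

/-- LTL formulas: letters, falsum, implication, Next, Until.
Other Boolean connectives are defined as abbreviations. -/
inductive Fml : Type
  | letter : ℕ → Fml
  | bot : Fml
  | imp : Fml → Fml → Fml
  | next : Fml → Fml
  | untl : Fml → Fml → Fml
deriving DecidableEq

namespace Fml
def neg (φ : Fml) : Fml := imp φ bot
def top : Fml := neg bot
def conj (φ ψ : Fml) : Fml := neg (imp φ (neg ψ))
def disj (φ ψ : Fml) : Fml := imp (neg φ) ψ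
/-- □φ abbreviates ¬(⊤ U ¬φ). -/
def box (φ : Fml) : Fml := neg (untl top (neg φ))
end Fml

/-- Truth in a model on the non-transitive linear frame determined by `t : ℕ → ℕ`:
`φ U ψ` at `a` looks only as far as `t a`. -/
def sat (t : ℕ → ℕ) (V : ℕ → Set ℕ) : Fml → ℕ → Prop
  | .letter p, a => a ∈ V p
  | .bot, _ => False
  | .imp φ ψ, a => sat t V φ a → sat t V ψ a
  | .next φ, a => sat t V φ (a + 1)
  | .untl φ ψ, a => ∃ b, a ≤ b ∧ b ≤ t a ∧ sat t V ψ b ∧ ∀ c, a ≤ c → c < b → sat t V φ c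

/-- A non-transitive linear frame: `t i > i` and `t` is increasing on successive points. -/
def NTFrame (t : ℕ → ℕ) : Prop := (∀ i, i < t i) ∧ (∀ i, t i < t (i + 1))

/-- The logic LTL_NT. -/
def LTLNT : Set Fml := {φ | ∀ t, NTFrame t → ∀ V a, sat t V φ a}

/-- Standard LTL semantics on ⟨ℕ, ≤, Next⟩. -/
def satStd (V : ℕ → Set ℕ) : Fml → ℕ → Prop
  | .letter p, a => a ∈ V p
  | .bot, _ => False
  | .imp φ ψ, a => satStd V φ a → satStd V ψ a
  | .next φ, a => satStd V φ (a + 1)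
  | .untl φ ψ, a => ∃ b, a ≤ b ∧ satStd V ψ b ∧ ∀ c, a ≤ c → c < b → satStd V φ c

/-- The standard linear temporal logic LTL. -/
def LTL : Set Fml := {φ | ∀ V a, satStd V φ a}

/-- The logic LTL_NT(m) of uniform intransitivity `m` (frame with `t i = i + m`). -/
def LTLNTm (m : ℕ) : Set Fml := {φ | ∀ V a, sat (· + m) V φ a}

/-- An inference rule: a finite list of premises and a conclusion. -/
structure Rule where
  prem : List Fml
  concl : Fml

/-- A rule is valid in a model iff truth of all premises at all points implies
truth of the conclusion at all points. -/
def validInModel (t : ℕ → ℕ) (V : ℕ → Set ℕ) (r : Rule) : Prop :=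
  (∀ φ ∈ r.prem, ∀ a, sat t V φ a) → ∀ a, sat t V r.concl a

/-- A rule is valid in a frame iff it is valid in every model on it. -/
def validInFrame (t : ℕ → ℕ) (r : Rule) : Prop := ∀ V, validInModel t V r

/-- Size of a formula. -/
def Fml.size : Fml → ℕ
  | .letter _ => 1
  | .bot => 1
  | .imp φ ψ => φ.size + ψ.size + 1
  | .next φ => φ.size + 1
  | .untl φ ψ => φ.size + ψ.size + 1

/-- Size of a rule. -/
def Rule.size (r : Rule) : ℕ := (r.prem.map Fml.size).sum + r.concl.size

/-- An injective encoding of formulas into ℕ (to speak about computability). -/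
def encF : Fml → ℕ
  | .letter p => Nat.pair 0 p
  | .bot => Nat.pair 1 0
  | .imp φ ψ => Nat.pair 2 (Nat.pair (encF φ) (encF ψ))
  | .next φ => Nat.pair 3 (encF φ)
  | .untl φ ψ => Nat.pair 4 (Nat.pair (encF φ) (encF ψ))

def encL : List Fml → ℕ
  | [] => 0
  | φ :: l => Nat.pair (encF φ) (encL l) + 1

/-- An injective encoding of rules into ℕ. -/
def encRule (r : Rule) : ℕ := Nat.pair (encL r.prem) (encF r.concl)

/-- A literal: `φ` or `¬φ` according to a Boolean flag (`α⁰ = α`, `α¹ = ¬α`). -/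
def lit (b : Bool) (φ : Fml) : Fml := if b then φ else φ.neg

/-- Conjunction of a list of formulas. -/
def bigConj : List Fml → Fml
  | [] => Fml.top
  | φ :: l => (bigConj l).conj φ

/-- Disjunction of a list of formulas. -/
def bigDisj : List Fml → Fml
  | [] => Fml.bot
  | φ :: l => (bigDisj l).disj φ

/-- The premise of a rule in reduced normal form: a disjunction over `j < l` of
conjunctions of literals over `xᵢ`, `N xᵢ` (for `i < n`) and `xᵢ U x_k` (for `i ≠ k`). -/
def rnfPremise (n l : ℕ) (t0 t1 : Fin l → Fin n → Bool)
    (t2 : Fin l → Fin n → Fin n → Bool) : Fml :=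
  bigDisj ((List.finRange l).map fun j =>
    bigConj ((List.finRange n).map (fun i => lit (t0 j i) (.letter i)) ++
      (List.finRange n).map (fun i => lit (t1 j i) (.next (.letter i))) ++
      ((List.finRange n).flatMap fun i =>
        ((List.finRange n).filter (fun k => k ≠ i)).map fun k =>
          lit (t2 j i k) (.untl (.letter i) (.letter k))))) 

/-- `IsRNF n l r`: the rule `r` is in reduced normal form with `n` letters and
`l` disjuncts, i.e. of the shape `ε / x₁`. -/
def IsRNF (n l : ℕ) (r : Rule) : Prop :=
  0 < n ∧ 0 < l ∧ r.concl = .letter 0 ∧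
    ∃ t0 t1 t2, r.prem = [rnfPremise n l t0 t1 t2]

/-- Next relation of the finite frame ℱ(N(r)): it wraps the last point `T` to `g`. -/
def wNext (T g : ℕ) (a : ℕ) : ℕ := if a = T then g else a + 1

/-- Truth in a model on the finite frame `ℱ(N(r))` obtained from the frame of `t`:
the base set is `[0, t^[r+1] 0]`, `T = t^[r+1] 0` is the last point, whose `Next` is
`G = t^[g] 0`; `until` from `a` follows `wNext` for at most `t a - a` steps, so on the
last interval it acts as if the interval following it were `[t^[g] 0, t^[g+1] 0]`. -/
def satFin (t : ℕ → ℕ) (T G : ℕ) (V : ℕ → Set ℕ) : Fml → ℕ → Prop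
  | .letter p, a => a ∈ V p
  | .bot, _ => False
  | .imp φ ψ, a => satFin t T G V φ a → satFin t T G V ψ a
  | .next φ, a => satFin t T G V φ (wNext T G a)
  | .untl φ ψ, a => ∃ k, k ≤ t a - a ∧ satFin t T G V ψ ((wNext T G)^[k] a) ∧
      ∀ j < k, satFin t T G V φ ((wNext T G)^[j] a)

/-- `r` is refuted by `V` in the finite frame `ℱ(N(rr))` (with parameter `g`) built
from the frame of `t`: all premises hold at every point of the frame, while the
conclusion fails at some point. -/
def refutedFin (t : ℕ → ℕ) (rr g : ℕ) (V : ℕ → Set ℕ) (r : Rule) : Prop :=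
  (∀ φ ∈ r.prem, ∀ a ≤ t^[rr + 1] 0, satFin t (t^[rr + 1] 0) (t^[g] 0) V φ a) ∧
    ∃ a ≤ t^[rr + 1] 0, ¬ satFin t (t^[rr + 1] 0) (t^[g] 0) V r.concl a

/-- Temporal degree: maximal nesting depth of `N` and `U`. -/
def tdeg : Fml → ℕ
  | .letter _ => 0
  | .bot => 0
  | .imp φ ψ => max (tdeg φ) (tdeg ψ)
  | .next φ => tdeg φ + 1
  | .untl φ ψ => max (tdeg φ) (tdeg ψ) + 1

/-- `i`-fold application of `N`. -/
def nPow : ℕ → Fml → Fml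
  | 0, φ => φ
  | k + 1, φ => .next (nPow k φ)

/-- Substitution of formulas for letters. -/
def subst (σ : ℕ → Fml) : Fml → Fml
  | .letter p => σ p
  | .bot => .bot
  | .imp φ ψ => .imp (subst σ φ) (subst σ ψ)
  | .next φ => .next (subst σ φ)
  | .untl φ ψ => .untl (subst σ φ) (subst σ ψ)

/-- A rule is admissible in a logic `L` iff every substitution making all premises
theorems of `L` makes the conclusion a theorem of `L`. -/
def Admissible (L : Set Fml) (r : Rule) : Prop :=
  ∀ σ : ℕ → Fml, (∀ φ ∈ r.prem, subst σ φ ∈ L) → subst σ r.concl ∈ L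

namespace NT
open Finset

/-- Total decoding of formulas. -/
def dec (n : ℕ) : Fml :=
  if (Nat.unpair n).1 = 0 then .letter (Nat.unpair n).2
  else if (Nat.unpair n).1 = 2 then
    .imp (dec (Nat.unpair (Nat.unpair n).2).1) (dec (Nat.unpair (Nat.unpair n).2).2)
  else if (Nat.unpair n).1 = 3 then .next (dec (Nat.unpair n).2)
  else if (Nat.unpair n).1 = 4 then
    .untl (dec (Nat.unpair (Nat.unpair n).2).1) (dec (Nat.unpair (Nat.unpair n).2).2)
  else .bot
termination_by n
decreasing_by
  all_goals
    have h1 := Nat.unpair_add_le n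
    have h2 := Nat.unpair_left_le (Nat.unpair n).2
    have h3 := Nat.unpair_right_le (Nat.unpair n).2
    omega

theorem dec_letter (p : ℕ) : dec (Nat.pair 0 p) = .letter p := by
  rw [dec]; simp
theorem dec_bot : dec (Nat.pair 1 0) = .bot := by
  rw [dec]; simp
theorem dec_imp (x y : ℕ) : dec (Nat.pair 2 (Nat.pair x y)) = .imp (dec x) (dec y) := by
  rw [dec]; simp
theorem dec_next (x : ℕ) : dec (Nat.pair 3 x) = .next (dec x) := by
  rw [dec]; simp
theorem dec_untl (x y : ℕ) : dec (Nat.pair 4 (Nat.pair x y)) = .untl (dec x) (dec y) := by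
  rw [dec]; simp

theorem dec_enc (φ : Fml) : dec (encF φ) = φ := by
  induction φ with
  | letter p => exact dec_letter p
  | bot => exact dec_bot
  | imp φ ψ h1 h2 => rw [encF, dec_imp, h1, h2]
  | next φ h1 => rw [encF, dec_next, h1]
  | untl φ ψ h1 h2 => rw [encF, dec_untl, h1, h2]

theorem tdeg_le (φ : Fml) : tdeg φ ≤ encF φ := by
  induction φ with
  | letter p => simp [tdeg]
  | bot => simp [tdeg]
  | imp φ ψ h1 h2 =>
    have := Nat.add_le_pair 2 (Nat.pair (encF φ) (encF ψ))
    have := Nat.add_le_pair (encF φ) (encF ψ)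
    simp only [tdeg, encF]; omega
  | next φ h1 =>
    have := Nat.add_le_pair 3 (encF φ)
    simp only [tdeg, encF]; omega
  | untl φ ψ h1 h2 =>
    have := Nat.add_le_pair 4 (Nat.pair (encF φ) (encF ψ))
    have := Nat.add_le_pair (encF φ) (encF ψ)
    simp only [tdeg, encF]; omega

/-- A finite carrier which is good for labels `lab`. -/
structure Good (t : ℕ → ℕ) (lab : ℕ → ℕ → Prop) (n M : ℕ) (S : Finset ℕ) : Prop where
  zero : 0 ∈ S
  cl : ∀ x ∈ S, x < M → t x ∈ S
  nxt : ∀ x ∈ S, x < M → ∀ y ∈ S, x < y → (∀ z ∈ S, x < z → y ≤ z) →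
    ∀ c, Nat.pair 3 c ≤ n → (lab (Nat.pair 3 c) x ↔ lab c y)
  unt : ∀ x ∈ S, x < M → ∀ c d, Nat.pair 4 (Nat.pair c d) ≤ n →
    (lab (Nat.pair 4 (Nat.pair c d)) x ↔
      ∃ b ∈ S, x ≤ b ∧ b ≤ t x ∧ lab d b ∧ ∀ e ∈ S, x ≤ e → e < b → lab c e)

/-- no image point in `[u,b]` -/
def NoIm (t : ℕ → ℕ) (M : ℕ) (S : Finset ℕ) (u b : ℕ) : Prop :=
  ∀ z ∈ S, z < M → u ≤ t z → b < t z

def PA (t : ℕ → ℕ) (lab : ℕ → ℕ → Prop) (M : ℕ) (S : Finset ℕ) (c d u : ℕ) : Prop :=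
  ∃ b ∈ S, u ≤ b ∧ NoIm t M S u b ∧ lab d b ∧ ∀ e ∈ S, u ≤ e → e < b → lab c e

def PG (t : ℕ → ℕ) (lab : ℕ → ℕ → Prop) (M : ℕ) (S : Finset ℕ) (c u : ℕ) : Prop :=
  ∀ e ∈ S, u ≤ e → NoIm t M S u e → lab c e

theorem Good.delete {t : ℕ → ℕ} {lab : ℕ → ℕ → Prop} {n M : ℕ} {S : Finset ℕ}
    (h : Good t lab n M S) {x y : ℕ} (hx : x ∈ S) (hy : y ∈ S) (h0 : 0 < x) (hxy : x < y)
    (him : NoIm t M S x y)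
    (hl : ∀ c ≤ n, lab c x ↔ lab c y)
    (hA : ∀ c ≤ n, ∀ d ≤ n, PA t lab M S c d x ↔ PA t lab M S c d y)
    (hG : ∀ c ≤ n, PG t lab M S c x ↔ PG t lab M S c y) :
    Good t lab n M (S.filter (fun s => ¬ (x ≤ s ∧ s < y))) := by
  constructor
  · simp [h.zero]; omega
  · intro z hz hzM
    simp only [mem_filter] at hz ⊢
    refine ⟨h.cl z hz.1 hzM, ?_⟩
    have := him z hz.1 hzM
    omega
  · intro z hz hzM v hv hzv hno c hc
    simp only [mem_filter] at hz hv hno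
    have hcn : c ≤ n := le_trans (Nat.right_le_pair _ _) hc
    by_cases hs : ∃ s ∈ S, z < s ∧ s < v
    · obtain ⟨s, hsS, hzs, hsv⟩ := hs
      have hsxy : x ≤ s ∧ s < y := by
        by_contra hcon
        have := hno s ⟨hsS, hcon⟩ hzs
        omega
      have hzx : z < x := by omega
      have hvy : v = y := by
        have := hno y ⟨hy, by omega⟩ (by omega)
        omega
      subst hvy
      rw [← hl c hcn]
      apply h.nxt z hz.1 hzM x hx hzx _ c hc
      intro w hw hzw
      by_contra hcon
      have := hno w ⟨hw, by omega⟩ hzw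
      omega
    · apply h.nxt z hz.1 hzM v hv.1 hzv _ c hc
      intro w hw hzw
      by_contra hcon
      exact hs ⟨w, hw, hzw, by omega⟩
  · intro z hz hzM c d hcd
    simp only [mem_filter] at hz
    have hcn : c ≤ n := le_trans (Nat.left_le_pair _ _) (le_trans (Nat.right_le_pair _ _) hcd)
    have hdn : d ≤ n := le_trans (Nat.right_le_pair _ _) (le_trans (Nat.right_le_pair _ _) hcd)
    rw [h.unt z hz.1 hzM c d hcd]
    have himz := him z hz.1 hzM
    constructor
    · rintro ⟨b, hb, hzb, hbt, hdb, hce⟩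
      by_cases hbxy : x ≤ b ∧ b < y
      · have hzx : z < x := by omega
        have hax : PA t lab M S c d x := by
          refine ⟨b, hb, hbxy.1, ?_, hdb, fun e he h1 h2 => hce e he (by omega) h2⟩
          intro z' hz' hw_M h1
          have := him z' hz' hw_M h1
          omega
        obtain ⟨b', hb', hyb', hni, hdb', hce'⟩ := (hA c hcn d hdn).1 hax
        refine ⟨b', by simp only [mem_filter]; exact ⟨hb', by omega⟩, by omega, ?_, hdb', ?_⟩
        · have := hni z hz.1 hzM (by omega)
          omega
        · intro e he h1 h2
          simp only [mem_filter] at he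
          by_cases hex : e < x
          · exact hce e he.1 h1 (by omega)
          · exact hce' e he.1 (by omega) h2
      · refine ⟨b, by simp only [mem_filter]; exact ⟨hb, hbxy⟩, hzb, hbt, hdb, ?_⟩
        intro e he
        simp only [mem_filter] at he
        exact hce e he.1
    · rintro ⟨b, hb, hzb, hbt, hdb, hce⟩
      simp only [mem_filter] at hb hce
      by_cases hcase : z < x ∧ y ≤ b
      · obtain ⟨hzx, hyb⟩ := hcase
        by_cases hni : NoIm t M S y b
        · have hay : PA t lab M S c d y :=
            ⟨b, hb.1, hyb, hni, hdb, fun e he h1 h2 => hce e ⟨he, by omega⟩ (by omega) h2⟩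
          obtain ⟨b', hb', hyb', hni, hdb', hce'⟩ := (hA c hcn d hdn).2 hay
          refine ⟨b', hb', by omega, ?_, hdb', ?_⟩
          · have := hni z hz.1 hzM (by omega)
            omega
          · intro e he h1 h2
            by_cases hex : e < x
            · exact hce e ⟨he, by omega⟩ h1 (by omega)
            · exact hce' e he (by omega) h2
        · have hgy : PG t lab M S c y := by
            intro e he h1 h2
            apply hce e ⟨he, by omega⟩ (by omega)
            by_contra hcon
            apply hni
            intro z' hz' hw_M h3
            have := h2 z' hz' hw_M h3
            omega
          have hgx := (hG c hcn).2 hgy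
          refine ⟨b, hb.1, hzb, hbt, hdb, ?_⟩
          intro e he h1 h2
          by_cases hexy : x ≤ e ∧ e < y
          · apply hgx e he hexy.1
            intro z' hz' hw_M h3
            have := him z' hz' hw_M h3
            omega
          · exact hce e ⟨he, hexy⟩ h1 h2
      · refine ⟨b, hb.1, hzb, hbt, hdb, ?_⟩
        intro e he h1 h2
        exact hce e ⟨he, by omega⟩ h1 h2

open Classical in
/-- Profile of a point. -/
noncomputable def prof (t : ℕ → ℕ) (lab : ℕ → ℕ → Prop) (n M : ℕ) (S : Finset ℕ) (u : ℕ) :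
    Finset ((ℕ × ℕ) × ℕ) :=
  ((range 3 ×ˢ range (n+1)) ×ˢ range (n+1)).filter fun q =>
    if q.1.1 = 0 then lab q.1.2 u else if q.1.1 = 1 then PA t lab M S q.1.2 q.2 u
      else PG t lab M S q.1.2 u

theorem prof_eq {t : ℕ → ℕ} {lab : ℕ → ℕ → Prop} {n M : ℕ} {S : Finset ℕ} {x y : ℕ}
    (h : prof t lab n M S x = prof t lab n M S y) :
    (∀ c ≤ n, lab c x ↔ lab c y) ∧
    (∀ c ≤ n, ∀ d ≤ n, PA t lab M S c d x ↔ PA t lab M S c d y) ∧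
    (∀ c ≤ n, PG t lab M S c x ↔ PG t lab M S c y) := by
  have key : ∀ i c d, ((i, c), d) ∈ prof t lab n M S x ↔ ((i, c), d) ∈ prof t lab n M S y := by
    rw [h]; simp
  refine ⟨fun c hc => ?_, fun c hc d hd => ?_, fun c hc => ?_⟩
  · have := key 0 c 0
    simpa [prof, Nat.lt_succ_iff, hc] using this
  · have := key 1 c d
    simpa [prof, Nat.lt_succ_iff, hc, hd] using this
  · have := key 2 c 0
    simpa [prof, Nat.lt_succ_iff, hc] using this

def CC (n : ℕ) : ℕ := 2 ^ (3 * (n+1) * (n+1))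

theorem level_bound {t : ℕ → ℕ} (ht : StrictMono t) {lab : ℕ → ℕ → Prop} {n M : ℕ} {S : Finset ℕ}
    (h : Good t lab n M S)
    (hmin : ∀ S', Good t lab n M S' → S' ⊆ S → S.card ≤ S'.card) (m : ℕ) :
    (S.filter (· < t m)).card + 1 ≤ ((S.filter (· < m)).card + 1) * (CC n + 2) := by
  classical
  set T := (S.filter (· < m)).card with hT
  let isIm : ℕ → Prop := fun p => ∃ z ∈ S, z < M ∧ t z = p
  let A := S.filter (fun p => p < t m ∧ ¬ isIm p ∧ 0 < p)
  let cnt : ℕ → ℕ := fun p => (S.filter (fun z => z < M ∧ t z ≤ p)).card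
  have hsub : S.filter (· < t m) ⊆ insert 0 ((S.filter (· < m)).image t ∪ A) := by
    intro p hp
    simp only [mem_filter] at hp
    simp only [mem_insert, mem_union, mem_image, mem_filter, A]
    by_cases hp0 : p = 0
    · exact Or.inl hp0
    · right
      by_cases him : isIm p
      · left
        obtain ⟨z, hz, hzM, rfl⟩ := him
        exact ⟨z, ⟨hz, ht.lt_iff_lt.1 hp.2⟩, rfl⟩
      · right
        exact ⟨hp.1, hp.2, him, by omega⟩
  have hAc : A.card ≤ (T + 1) * CC n := by
    let B := range (T+1) ×ˢ ((range 3 ×ˢ range (n+1)) ×ˢ range (n+1)).powerset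
    have hB : B.card = (T+1) * CC n := by
      simp [B, CC]
    rw [← hB]
    apply card_le_card_of_injOn (fun p => (cnt p, prof t lab n M S p))
    · intro p hp
      have hp := mem_filter.1 (mem_coe.1 hp)
      apply mem_coe.2
      apply mem_product.2
      refine ⟨?_, ?_⟩
      · simp only [mem_range, Nat.lt_succ_iff, hT, cnt]
        apply card_le_card
        intro z hz
        simp only [mem_filter] at hz ⊢
        exact ⟨hz.1, ht.lt_iff_lt.1 (lt_of_le_of_lt hz.2.2 hp.2.1)⟩
      · exact mem_powerset.2 (filter_subset _ _)
    · have main : ∀ p ∈ A, ∀ q ∈ A, cnt p = cnt q → prof t lab n M S p = prof t lab n M S q →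
          ¬ p < q := by
        intro p hp q hq hc hpr hlt
        have hp := mem_filter.1 hp
        have hq := mem_filter.1 hq
        obtain ⟨h1, h2, h3⟩ := prof_eq hpr
        have hfe : S.filter (fun z => z < M ∧ t z ≤ p) = S.filter (fun z => z < M ∧ t z ≤ q) := by
          apply eq_of_subset_of_card_le
          · intro z hz
            simp only [mem_filter] at hz ⊢
            exact ⟨hz.1, hz.2.1, by omega⟩
          · exact hc.ge
        have hni : NoIm t M S p q := by
          intro z hz hzM hpz
          by_contra hcon
          have : z ∈ S.filter (fun z => z < M ∧ t z ≤ q) := by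
            simp only [mem_filter]; exact ⟨hz, hzM, by omega⟩
          rw [← hfe] at this
          simp only [mem_filter] at this
          exact hp.2.2.1 ⟨z, hz, hzM, by omega⟩
        have hg := h.delete hp.1 hq.1 hp.2.2.2 hlt hni h1 h2 h3
        have hle := hmin _ hg (filter_subset _ _)
        have : (S.filter (fun s => ¬ (p ≤ s ∧ s < q))).card < S.card := by
          apply card_lt_card
          rw [filter_ssubset]
          exact ⟨p, hp.1, by simp [hlt]⟩
        omega
      intro p hp q hq hpq
      simp only [Prod.mk.injEq] at hpq
      have a1 := main p hp q hq hpq.1 hpq.2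
      have a2 := main q hq p hp hpq.1.symm hpq.2.symm
      omega
  have h1 := card_le_card hsub
  have h2 := card_insert_le 0 ((S.filter (· < m)).image t ∪ A)
  have h3 := card_union_le ((S.filter (· < m)).image t) A
  have h4 : ((S.filter (· < m)).image t).card ≤ T := card_image_le
  nlinarith

theorem bound {t : ℕ → ℕ} (ht : StrictMono t) {lab : ℕ → ℕ → Prop} {n M : ℕ} {S : Finset ℕ}
    (h : Good t lab n M S)
    (hmin : ∀ S', Good t lab n M S' → S' ⊆ S → S.card ≤ S'.card) (k : ℕ) :
    (S.filter (· < t^[k] 0)).card + 1 ≤ (CC n + 2) ^ k := by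
  induction k with
  | zero => simp
  | succ k ih =>
    rw [Function.iterate_succ_apply', pow_succ]
    exact (level_bound ht h hmin _).trans (Nat.mul_le_mul_right _ ih)

end NT

namespace NT
open Finset

/-- The check performed on the (finite) table `g`. -/
def Chk (n D : ℕ) (g : ℕ → ℕ → ℕ) : Prop :=
  g 1 0 = 0 ∧
  (∀ k < n, g 1 k < g 1 (k+1) ∧ g 1 (k+1) = g 0 (g 1 k)) ∧
  (∀ a < D, a < g 1 n → a < g 0 a ∧ (a + 1 < g 1 n → g 0 a < g 0 (a+1))) ∧
  (∀ a < D, Nat.pair 1 0 ≤ n → ¬ g (Nat.pair 1 0 + 2) a = 1) ∧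
  (∀ a < D, ∀ x < n+1, ∀ y < n+1, Nat.pair 2 (Nat.pair x y) ≤ n →
    (g (Nat.pair 2 (Nat.pair x y) + 2) a = 1 ↔ (g (x+2) a = 1 → g (y+2) a = 1))) ∧
  (∀ a < D, a < g 1 n → ∀ x < n+1, Nat.pair 3 x ≤ n →
    (g (Nat.pair 3 x + 2) a = 1 ↔ g (x+2) (a+1) = 1)) ∧
  (∀ a < D, a < g 1 n → ∀ x < n+1, ∀ y < n+1, Nat.pair 4 (Nat.pair x y) ≤ n →
    (g (Nat.pair 4 (Nat.pair x y) + 2) a = 1 ↔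
      ∃ b < D, a ≤ b ∧ b ≤ g 0 a ∧ g (y+2) b = 1 ∧ ∀ e < D, a ≤ e → e < b → g (x+2) e = 1)) ∧
  g (n+2) 0 = 1

theorem sound {n D : ℕ} {g : ℕ → ℕ → ℕ} (hD : ∀ r i, g r i < D) (h : Chk n D g) (φ : Fml)
    (hn : n = encF φ) : ∃ t V a, NTFrame t ∧ sat t V φ a := by
  obtain ⟨h0, hm, ht, hb, hi, hx, hu, hf⟩ := h
  set M := g 1 n with hM
  let T : ℕ → ℕ := fun i => if i < M then g 0 i else i + D
  let V : ℕ → Set ℕ := fun p => {a | g (Nat.pair 0 p + 2) a = 1}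
  have hMD : M < D := hD _ _
  have hT1 : ∀ i, i < T i := by
    intro i
    simp only [T]
    split_ifs with hi
    · exact (ht i (by omega) hi).1
    · omega
  have hT2 : ∀ i, T i < T (i+1) := by
    intro i
    simp only [T]
    have := hD 0 i
    by_cases h1 : i < M <;> by_cases h2 : i + 1 < M
    · simp only [h1, h2, if_true]
      exact (ht i (by omega) h1).2 h2
    · simp only [h1, h2, if_true, if_false]; omega
    · omega
    · simp only [h1, h2, if_false]; omega
  have hTm : StrictMono T := strictMono_nat_of_lt_succ hT2
  have hmM : ∀ j k, k + j = n → g 1 k + j ≤ M := by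
    intro j
    induction j with
    | zero => intro k hk; simp at hk; subst hk; exact le_rfl
    | succ j ih =>
      intro k hk
      have := ih (k+1) (by omega)
      have := (hm k (by omega)).1
      omega
  have hTk : ∀ k < n, ∀ x ≤ g 1 k, x < M ∧ T x ≤ g 1 (k+1) ∧ T x = g 0 x := by
    intro k hk x hx
    have h1 := hmM (n - k) k (by omega)
    have h2 : T (g 1 k) = g 1 (k+1) := by
      rw [(hm k hk).2]; simp only [T]; rw [if_pos (by omega)]
    refine ⟨by omega, ?_, by simp only [T]; rw [if_pos (by omega)]⟩
    rw [← h2]; exact hTm.monotone hx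
  have main : ∀ χ : Fml, encF χ ≤ n → ∀ k, k + tdeg χ ≤ n → ∀ x ≤ g 1 k,
      (sat T V χ x ↔ g (encF χ + 2) x = 1) := by
    intro χ
    induction χ with
    | letter p => intro _ k _ x _; rfl
    | bot =>
      intro he k hk x hx
      have := hb x (lt_of_le_of_lt hx (hD _ _)) he
      simp only [sat, encF, this]
    | imp φ ψ ih1 ih2 =>
      intro he k hk x hx
      simp only [encF] at he ⊢
      have e0 := Nat.right_le_pair 2 (Nat.pair (encF φ) (encF ψ))
      have e1 := Nat.left_le_pair (encF φ) (encF ψ)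
      have e2 := Nat.right_le_pair (encF φ) (encF ψ)
      simp only [tdeg] at hk
      rw [hi x (lt_of_le_of_lt hx (hD _ _)) (encF φ) (by omega) (encF ψ) (by omega) he]
      simp only [sat]
      rw [ih1 (by omega) k (by omega) x hx, ih2 (by omega) k (by omega) x hx]
    | next φ ih =>
      intro he k hk x hx'
      simp only [encF] at he ⊢
      have e0 := Nat.right_le_pair 3 (encF φ)
      simp only [tdeg] at hk
      obtain ⟨hxM, hTx, -⟩ := hTk k (by omega) x hx'
      have := hT1 x
      rw [hx x (lt_of_le_of_lt hx' (hD _ _)) hxM (encF φ) (by omega) he]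
      simp only [sat]
      exact ih (by omega) (k+1) (by omega) (x+1) (by omega)
    | untl φ ψ ih1 ih2 =>
      intro he k hk x hx'
      simp only [encF] at he ⊢
      have e0 := Nat.right_le_pair 4 (Nat.pair (encF φ) (encF ψ))
      have e1 := Nat.left_le_pair (encF φ) (encF ψ)
      have e2 := Nat.right_le_pair (encF φ) (encF ψ)
      simp only [tdeg] at hk
      obtain ⟨hxM, hTx, hTe⟩ := hTk k (by omega) x hx'
      have hkD := hD 1 (k+1)
      rw [hu x (lt_of_le_of_lt hx' (hD _ _)) hxM (encF φ) (by omega) (encF ψ) (by omega) he]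
      simp only [sat, ← hTe]
      constructor
      · rintro ⟨b, h1, h2, h3, h4⟩
        refine ⟨b, by omega, h1, h2, (ih2 (by omega) (k+1) (by omega) b (by omega)).1 h3, ?_⟩
        intro e _ h5 h6
        exact (ih1 (by omega) (k+1) (by omega) e (by omega)).1 (h4 e h5 h6)
      · rintro ⟨b, h0, h1, h2, h3, h4⟩
        refine ⟨b, h1, h2, (ih2 (by omega) (k+1) (by omega) b (by omega)).2 h3, ?_⟩
        intro e h5 h6
        exact (ih1 (by omega) (k+1) (by omega) e (by omega)).2 (h4 e (by omega) h5 h6)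
  refine ⟨T, V, 0, ⟨hT1, hT2⟩, ?_⟩
  have htd := tdeg_le φ
  rw [main φ (by omega) 0 (by omega) 0 (by omega), ← hn]
  exact hf

def DD (n : ℕ) : ℕ := (CC n + 2) ^ (n+1) + n + 2

theorem exists_good {t : ℕ → ℕ} (ht : NTFrame t) (V : ℕ → Set ℕ) (n : ℕ) :
    ∃ S : Finset ℕ, Good t (fun c x => sat t V (dec c) x) n (t^[n] 0) S ∧ S.card < DD n := by
  classical
  have hmono : StrictMono t := strictMono_nat_of_lt_succ ht.2
  set M := t^[n] 0 with hM
  set lab : ℕ → ℕ → Prop := fun c x => sat t V (dec c) x with hlab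
  have hinit : Good t lab n M (range (t M)) := by
    constructor
    · simp; have := ht.1 M; omega
    · intro x _ hx; simp; exact hmono hx
    · intro x hx hxM y hy hxy hno c hc
      have hMM := ht.1 M
      have : y = x + 1 := by
        have := hno (x+1) (by simp; omega) (by omega)
        omega
      subst this
      simp only [hlab, dec_next, sat]
    · intro x hx hxM c d hcd
      simp only [hlab, dec_untl, sat]
      have := hmono hxM
      constructor
      · rintro ⟨b, h1, h2, h3, h4⟩
        exact ⟨b, by simp; omega, h1, h2, h3, fun e _ => h4 e⟩
      · rintro ⟨b, h0, h1, h2, h3, h4⟩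
        refine ⟨b, h1, h2, h3, fun e h5 h6 => h4 e (by simp; omega) h5 h6⟩
  have hex : ∃ k, ∃ S, Good t lab n M S ∧ S ⊆ range (t M) ∧ S.card = k :=
    ⟨_, _, hinit, Subset.rfl, rfl⟩
  obtain ⟨S, hS, hsub, hc⟩ := Nat.find_spec hex
  refine ⟨S, hS, ?_⟩
  have hmin : ∀ S', Good t lab n M S' → S' ⊆ S → S.card ≤ S'.card := by
    intro S' hg hs
    rw [hc]
    exact Nat.find_min' hex ⟨S', hg, hs.trans hsub, rfl⟩
  have hb := bound hmono hS hmin (n+1)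
  rw [Function.iterate_succ_apply', filter_true_of_mem] at hb
  · unfold DD; omega
  · intro x hx
    exact mem_range.1 (hsub hx)

theorem shift (t : ℕ → ℕ) (ht : NTFrame t) (V : ℕ → Set ℕ) (a : ℕ) (χ : Fml) : ∀ i,
    sat (fun i => t (i + a) - a) (fun p => {i | i + a ∈ V p}) χ i ↔ sat t V χ (i + a) := by
  induction χ with
  | letter p => intro i; rfl
  | bot => intro i; rfl
  | imp φ ψ h1 h2 => intro i; simp only [sat, h1, h2]
  | next φ h1 => intro i; simp only [sat, h1]; rw [show i + 1 + a = i + a + 1 by omega]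
  | untl φ ψ h1 h2 =>
    intro i
    simp only [sat, h1, h2]
    have := ht.1 (i + a)
    constructor
    · rintro ⟨b, k1, k2, k3, k4⟩
      refine ⟨b + a, by omega, by omega, k3, fun c k5 k6 => ?_⟩
      have := k4 (c - a) (by omega) (by omega)
      rwa [Nat.sub_add_cancel (by omega)] at this
    · rintro ⟨b, k1, k2, k3, k4⟩
      refine ⟨b - a, by omega, by omega, ?_, fun c k5 k6 => k4 (c + a) (by omega) (by omega)⟩
      rwa [Nat.sub_add_cancel (by omega)]

theorem shift_frame {t : ℕ → ℕ} (ht : NTFrame t) (a : ℕ) : NTFrame (fun i => t (i + a) - a) := by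
  constructor
  · intro i; have := ht.1 (i+a); simp only; omega
  · intro i
    have h1 := ht.1 (i+a)
    have h2 := ht.2 (i+a)
    simp only
    rw [show i + 1 + a = i + a + 1 by omega]
    omega

theorem complete {t : ℕ → ℕ} (ht : NTFrame t) {V : ℕ → Set ℕ} {n D : ℕ} {S : Finset ℕ}
    (hS : Good t (fun c x => sat t V (dec c) x) n (t^[n] 0) S) (hSD : S.card < D) (hnD : n < D)
    (g : ℕ → ℕ → ℕ)
    (hg0 : ∀ a ≤ D, g 0 a = Nat.count (· ∈ S) (t (Nat.nth (· ∈ S) a)))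
    (hg1 : ∀ k ≤ D, g 1 k = Nat.count (· ∈ S) (t^[k] 0))
    (hg2 : ∀ c ≤ n, ∀ a ≤ D, g (c+2) a = 1 ↔ sat t V (dec c) (Nat.nth (· ∈ S) a))
    (hsat : sat t V (dec n) 0) : Chk n D g := by
  have hmono : StrictMono t := strictMono_nat_of_lt_succ ht.2
  set M := t^[n] 0 with hM
  set p : ℕ → Prop := (· ∈ S) with hp
  set e := Nat.nth p with he
  set ι := Nat.count p with hι
  have hfin : (Set.ofPred p).Finite := S.finite_toSet
  have hcard : hfin.toFinset.card = S.card := by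
    congr 1; ext x; simp [hp]
  have eι : ∀ x ∈ S, e (ι x) = x := fun x hx => Nat.nth_count hx
  have ιe : ∀ a < S.card, ι (e a) = a := fun a ha =>
    Nat.count_nth_of_lt_card_finite hfin (by rw [hcard]; exact ha)
  have eS : ∀ a < S.card, e a ∈ S := fun a ha =>
    Nat.nth_mem_of_lt_card hfin (by rw [hcard]; exact ha)
  have ιlt : ∀ x ∈ S, ι x < S.card := fun x hx => by
    rw [← hcard]; exact Nat.count_lt_card hfin hx
  have ιmono : Monotone ι := Nat.count_monotone p
  have ιst : ∀ x ∈ S, ∀ y, x < y → ι x < ι y := fun x hx y hxy => Nat.count_strict_mono hx hxy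
  have est : ∀ a b, a < b → b < S.card → e a < e b := fun a b hab hb =>
    Nat.nth_lt_nth_of_lt_card hfin hab (by rw [hcard]; exact hb)
  have emo : ∀ a b, a ≤ b → b < S.card → e a ≤ e b := fun a b hab hb =>
    Nat.nth_le_nth_of_lt_card hfin hab (by rw [hcard]; exact hb)
  have mlt : ∀ k, t^[k] 0 < t^[k+1] 0 := by
    intro k; rw [Function.iterate_succ_apply']; exact ht.1 _
  have msm : StrictMono (fun k => t^[k] 0) := strictMono_nat_of_lt_succ mlt
  have mS : ∀ k ≤ n, t^[k] 0 ∈ S := by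
    intro k
    induction k with
    | zero => intro _; exact hS.zero
    | succ k ih =>
      intro hk
      rw [Function.iterate_succ_apply']
      exact hS.cl _ (ih (by omega)) (msm (show k < n by omega))
  have hMS := mS n le_rfl
  have hg1n := hg1 n hnD.le
  have aM : ∀ a, a < ι M → a < S.card ∧ e a < M := fun a ha =>
    ⟨ha.trans (ιlt M hMS), Nat.nth_lt_of_lt_count ha⟩
  have e0 : e 0 = 0 := by
    have := eι 0 hS.zero
    rwa [hι, Nat.count_zero] at this
  refine ⟨?_, ?_, ?_, ?_, ?_, ?_, ?_, ?_⟩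
  · rw [hg1 0 (by omega)]; simp [hι]
  · intro k hk
    rw [hg1 k (by omega), hg1 (k+1) (by omega)]
    have hkS := mS k hk.le
    refine ⟨ιst _ hkS _ (mlt k), ?_⟩
    rw [hg0 _ (by have := ιlt _ hkS; omega), eι _ hkS, Function.iterate_succ_apply']
  · intro a ha haM
    rw [hg1n] at haM ⊢
    obtain ⟨h1, h2⟩ := aM a haM
    rw [hg0 a (by omega)]
    refine ⟨?_, fun ha1 => ?_⟩
    · have := ιst _ (eS a h1) _ (ht.1 (e a))
      rwa [ιe a h1] at this
    · rw [hg0 _ (by omega)]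
      obtain ⟨h3, h4⟩ := aM _ ha1
      exact ιst _ (hS.cl _ (eS a h1) h2) _ (hmono (est a (a+1) (by omega) h3))
  · intro a ha hb
    rw [hg2 _ hb a ha.le, dec_bot]
    exact id
  · intro a ha x hx y hy hxy
    rw [hg2 _ hxy a ha.le, hg2 x (by omega) a ha.le, hg2 y (by omega) a ha.le, dec_imp]
    rfl
  · intro a ha haM x hx hxn
    rw [hg1n] at haM
    obtain ⟨h1, h2⟩ := aM a haM
    rw [hg2 _ hxn a ha.le, hg2 x (by omega) (a+1) (by omega)]
    have h3 := ιst _ (eS a h1) _ (ht.1 (e a))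
    rw [ιe a h1] at h3
    have h4 := ιlt _ (hS.cl _ (eS a h1) h2)
    apply hS.nxt (e a) (eS a h1) h2 (e (a+1)) (eS _ (by omega)) (est _ _ (by omega) (by omega)) _ x hxn
    intro z hz haz
    have h5 := ιst _ (eS a h1) z haz
    rw [ιe a h1] at h5
    have := emo (a+1) (ι z) h5 (ιlt z hz)
    rwa [eι z hz] at this
  · intro a ha haM x hx y hy hxy
    rw [hg1n] at haM
    obtain ⟨h1, h2⟩ := aM a haM
    have htS := hS.cl _ (eS a h1) h2
    rw [hg2 _ hxy a ha.le, hg0 a ha.le]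
    refine (hS.unt (e a) (eS a h1) h2 x y hxy).trans ?_
    constructor
    · rintro ⟨b, hb, k1, k2, k3, k4⟩
      have hbl := ιlt b hb
      refine ⟨ι b, by omega, ?_, ιmono k2, ?_, ?_⟩
      · have := ιmono k1; rwa [ιe a h1] at this
      · rw [hg2 y (by omega) _ (by omega), eι b hb]; exact k3
      · intro c hc k5 k6
        rw [hg2 x (by omega) c hc.le]
        refine k4 _ (eS c (by omega)) (emo _ _ k5 (by omega)) ?_
        have := est c (ι b) k6 hbl
        rwa [eι b hb] at this
    · rintro ⟨b, hbD, k1, k2, k3, k4⟩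
      have hbc : b < S.card := lt_of_le_of_lt k2 (ιlt _ htS)
      rw [hg2 y (by omega) b hbD.le] at k3
      refine ⟨e b, eS b hbc, emo _ _ k1 hbc, ?_, k3, ?_⟩
      · have := emo _ _ k2 (ιlt _ htS)
        rwa [eι _ htS] at this
      · intro z hz k5 k6
        have q1 := ιmono k5
        rw [ιe a h1] at q1
        have q2 := ιst z hz _ k6
        rw [ιe b hbc] at q2
        have := (hg2 x (by omega) (ι z) (by omega)).1 (k4 (ι z) (by omega) q1 q2)
        rwa [eι z hz] at this
  · rw [hg2 n le_rfl 0 (by omega), e0]; exact hsat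

end NT

namespace NT

/-- The `i`-th digit of `w` in base `D`. -/
def dg (D w i : ℕ) : ℕ := w / D ^ i % D

theorem exists_digits {D : ℕ} (hD : 0 < D) (g : ℕ → ℕ) (hg : ∀ i, g i < D) (K : ℕ) :
    ∃ w < D ^ K, ∀ i < K, dg D w i = g i := by
  induction K with
  | zero => exact ⟨0, by simp, by simp⟩
  | succ K ih =>
    obtain ⟨w, hw, h⟩ := ih
    refine ⟨w + D ^ K * g K, ?_, ?_⟩
    · rw [pow_succ]
      have := hg K
      nlinarith [Nat.mul_le_mul_left (D ^ K) (show g K + 1 ≤ D from this)]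
    · intro i hi
      rcases Nat.lt_succ_iff_lt_or_eq.1 hi with h1 | rfl
      · rw [← h i h1]
        obtain ⟨j, rfl⟩ : ∃ j, K = i + (j + 1) := ⟨K - i - 1, by omega⟩
        unfold dg
        have : D ^ (i + (j+1)) * g (i + (j+1)) = D ^ i * (D * (D ^ j * g (i + (j+1)))) := by ring
        rw [this, Nat.add_mul_div_left _ _ (pow_pos hD i), Nat.add_mul_mod_self_left]
      · unfold dg
        rw [Nat.add_mul_div_left _ _ (pow_pos hD i), Nat.div_eq_of_lt hw, zero_add,
          Nat.mod_eq_of_lt (hg i)]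

def KK (n : ℕ) : ℕ := (DD n + n + 4) * (DD n + n + 4)

/-- The decision predicate. -/
def Dec (n : ℕ) : Prop := ∃ w < DD n ^ KK n, Chk n (DD n) (fun r i => dg (DD n) w (Nat.pair r i))

theorem dec_correct (φ : Fml) : Dec (encF φ) ↔ ∃ t V a, NTFrame t ∧ sat t V φ a := by
  classical
  have hD : 0 < DD (encF φ) := by unfold DD; omega
  constructor
  · rintro ⟨w, -, hw⟩
    exact sound (fun r i => Nat.mod_lt _ hD) hw φ rfl
  · rintro ⟨t', V', a, ht', hs⟩
    rw [← Nat.zero_add a, ← shift t' ht'] at hs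
    have ht := shift_frame ht' a
    generalize (fun i => t' (i + a) - a) = t at ht hs
    generalize (fun p => {i | i + a ∈ V' p}) = V at hs
    set n := encF φ with hn
    obtain ⟨S, hS, hc⟩ := exists_good ht V n
    have hfin : (Set.ofPred (· ∈ S)).Finite := S.finite_toSet
    have hcard : hfin.toFinset.card = S.card := by
      congr 1; ext x; simp
    have hcnt : ∀ x, Nat.count (· ∈ S) x < DD n := fun x => by
      have := Nat.count_le_card hfin x
      omega
    let G : ℕ → ℕ → ℕ := fun r a =>
      if r = 0 then Nat.count (· ∈ S) (t (Nat.nth (· ∈ S) a))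
      else if r = 1 then Nat.count (· ∈ S) (t^[a] 0)
      else if sat t V (dec (r - 2)) (Nat.nth (· ∈ S) a) then 1 else 0
    have hG : ∀ r a, G r a < DD n := by
      intro r a
      simp only [G]
      split_ifs
      · exact hcnt _
      · exact hcnt _
      · unfold DD; omega
      · exact hD
    obtain ⟨w, hw, hd⟩ := exists_digits hD (fun i => G (Nat.unpair i).1 (Nat.unpair i).2)
      (fun i => hG _ _) (KK n)
    refine ⟨w, hw, ?_⟩
    have hd' : ∀ r ≤ n + 2, ∀ a ≤ DD n, dg (DD n) w (Nat.pair r a) = G r a := by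
      intro r hr a ha
      rw [hd]
      · simp
      · have h1 := Nat.pair_lt_max_add_one_sq r a
        have h2 : max r a + 1 ≤ DD n + n + 4 := by omega
        unfold KK
        rw [sq] at h1
        exact h1.trans_le (Nat.mul_le_mul h2 h2)
    refine complete ht hS hc (by unfold DD; omega) _ ?_ ?_ ?_ ?_
    · intro a ha
      simp only [hd' 0 (by omega) a ha]; rfl
    · intro k hk
      simp only [hd' 1 (by omega) k hk]; rfl
    · intro c hc a ha
      simp only [hd' (c+2) (by omega) a ha, G]
      simp
    · rw [hn, dec_enc]; exact hs

section prim
variable {α : Type*} [Primcodable α]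

theorem pr_imp {p q : α → Prop} (hp : PrimrecPred p) (hq : PrimrecPred q) :
    PrimrecPred fun a => p a → q a :=
  (hp.not.or hq).of_eq fun a => by tauto

theorem pr_iff {p q : α → Prop} (hp : PrimrecPred p) (hq : PrimrecPred q) :
    PrimrecPred fun a => (p a ↔ q a) :=
  ((pr_imp hp hq).and (pr_imp hq hp)).of_eq fun a => by tauto

theorem pr_all {f : α → ℕ} {p : α → ℕ → Prop} (hf : Primrec f)
    (hp : PrimrecPred fun q : α × ℕ => p q.1 q.2) : PrimrecPred fun a => ∀ x < f a, p a x :=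
  ((PrimrecRel.forall_mem_list (R := fun (x : ℕ) (a : α) => p a x) (PrimrecRel.swap hp)).comp
    (Primrec.list_range.comp hf) Primrec.id).of_eq fun a => by simp

theorem pr_ex {f : α → ℕ} {p : α → ℕ → Prop} (hf : Primrec f)
    (hp : PrimrecPred fun q : α × ℕ => p q.1 q.2) : PrimrecPred fun a => ∃ x < f a, p a x :=
  ((PrimrecRel.exists_mem_list (R := fun (x : ℕ) (a : α) => p a x) (PrimrecRel.swap hp)).comp
    (Primrec.list_range.comp hf) Primrec.id).of_eq fun a => by simp

theorem pr_pow {f g : α → ℕ} (hf : Primrec f) (hg : Primrec g) : Primrec fun a => f a ^ g a := by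
  have h : Primrec₂ fun (a n : ℕ) => a ^ n :=
    (Primrec.nat_rec (f := fun _ : ℕ => 1) (g := fun a q => q.2 * a) (Primrec.const 1)
      (Primrec.nat_mul.comp (Primrec.snd.comp Primrec.snd) Primrec.fst).to₂).of_eq fun a n => by
        induction n with
        | zero => rfl
        | succ n ih => rw [pow_succ, ← ih]
  exact h.comp hf hg

theorem pr_add {f g : α → ℕ} (hf : Primrec f) (hg : Primrec g) : Primrec fun a => f a + g a :=
  Primrec.nat_add.comp hf hg
theorem pr_mul {f g : α → ℕ} (hf : Primrec f) (hg : Primrec g) : Primrec fun a => f a * g a :=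
  Primrec.nat_mul.comp hf hg
theorem pr_pair {f g : α → ℕ} (hf : Primrec f) (hg : Primrec g) :
    Primrec fun a => Nat.pair (f a) (g a) := Primrec₂.natPair.comp hf hg
theorem pr_le {f g : α → ℕ} (hf : Primrec f) (hg : Primrec g) : PrimrecPred fun a => f a ≤ g a :=
  Primrec.nat_le.comp hf hg
theorem pr_lt {f g : α → ℕ} (hf : Primrec f) (hg : Primrec g) : PrimrecPred fun a => f a < g a :=
  Primrec.nat_lt.comp hf hg
theorem pr_eq {f g : α → ℕ} (hf : Primrec f) (hg : Primrec g) : PrimrecPred fun a => f a = g a :=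
  Primrec.eq.comp hf hg
theorem pr_dg {D w i : α → ℕ} (hD : Primrec D) (hw : Primrec w) (hi : Primrec i) :
    Primrec fun a => dg (D a) (w a) (i a) :=
  Primrec.nat_mod.comp (Primrec.nat_div.comp hw (pr_pow hD hi)) hD
theorem pr_CC {f : α → ℕ} (hf : Primrec f) : Primrec fun a => CC (f a) :=
  pr_pow (Primrec.const 2) (pr_mul (pr_mul (Primrec.const 3) (pr_add hf (Primrec.const 1)))
    (pr_add hf (Primrec.const 1)))
theorem pr_DD {f : α → ℕ} (hf : Primrec f) : Primrec fun a => DD (f a) :=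
  pr_add (pr_add (pr_pow (pr_add (pr_CC hf) (Primrec.const 2)) (pr_add hf (Primrec.const 1))) hf)
    (Primrec.const 2)
theorem pr_KK {f : α → ℕ} (hf : Primrec f) : Primrec fun a => KK (f a) :=
  pr_mul (pr_add (pr_add (pr_DD hf) hf) (Primrec.const 4))
    (pr_add (pr_add (pr_DD hf) hf) (Primrec.const 4))
theorem pr_fst {β : Type*} [Primcodable β] {f : α → ℕ} (hf : Primrec f) :
    Primrec fun a : α × β => f a.1 := hf.comp Primrec.fst

theorem pr_id : Primrec fun a : α => a := Primrec.id
theorem pr_f {β γ : Type*} [Primcodable β] [Primcodable γ] {f : α → β × γ} (hf : Primrec f) :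
    Primrec fun a => (f a).1 := Primrec.fst.comp hf
theorem pr_s {β γ : Type*} [Primcodable β] [Primcodable γ] {f : α → β × γ} (hf : Primrec f) :
    Primrec fun a => (f a).2 := Primrec.snd.comp hf

end prim

theorem dec_primrec : PrimrecPred Dec := by
  unfold Dec Chk
  repeat' first
    | with_reducible exact Primrec.const _
    | with_reducible exact Primrec.id
    | with_reducible exact Primrec.snd
    | with_reducible exact Primrec.fst
    | with_reducible refine PrimrecPred.and ?_ ?_
    | with_reducible refine PrimrecPred.not ?_
    | with_reducible refine pr_all ?_ ?_
    | with_reducible refine pr_ex ?_ ?_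
    | with_reducible refine pr_iff ?_ ?_
    | with_reducible refine pr_imp ?_ ?_
    | with_reducible refine pr_le ?_ ?_
    | with_reducible refine pr_lt ?_ ?_
    | with_reducible refine pr_eq ?_ ?_
    | with_reducible refine pr_dg ?_ ?_ ?_
    | with_reducible refine pr_DD ?_
    | with_reducible refine pr_KK ?_
    | with_reducible refine pr_pair ?_ ?_
    | with_reducible refine pr_add ?_ ?_
    | with_reducible refine pr_pow ?_ ?_
  all_goals
    repeat' first
      | with_reducible exact pr_id
      | with_reducible exact Primrec.snd
      | with_reducible exact Primrec.fst
      | with_reducible refine pr_f ?_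
      | with_reducible refine pr_s ?_

end NT

/-- the satisfiability problem for LTL_NT is decidable. -/
theorem stmt5 :
    ∃ f : ℕ → Bool, Computable f ∧
      ∀ φ : Fml,
        (f (encF φ) = true ↔ ∃ t V a, NTFrame t ∧ sat t V φ a) := by
  classical
  refine ⟨fun n => decide (NT.Dec n), NT.dec_primrec.decide.to_comp, fun φ => ?_⟩
  rw [decide_eq_true_iff]
  exact NT.dec_correct φ
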